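/- Let K be a fractal square of order n with digit set D. If K is a dendrite, then K possesses the one-point intersection property: for any two distinct digits d, d′ ∈ D, the intersection ((K+d)/n) ∩ ((K+d′)/n) contains at most one point. -/

import Mathlib

open Set Pointwise

noncomputable section

/-- The canonical embedding of `ℤ × ℤ` into `ℝ × ℝ`. -/
def coeZ2 (d : ℤ × ℤ) : ℝ × ℝ := ((d.1 : ℝ), (d.2 : ℝ))

/-- The contraction similarity `x ↦ (x + d) / n` of the plane. -/
def pieceMap (n : ℕ) (d : ℤ × ℤ) (x : ℝ × ℝ) : ℝ × ℝ := (n : ℝ)⁻¹ • (x + coeZ2 d)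

/-- `K` is a fractal square of order `n` with digit set `D ⊆ {0,…,n-1}²`,
`1 < |D| < n²`: a nonempty compact set with `K = (K + D)/n`. -/
def IsFractalSquare (n : ℕ) (D : Set (ℤ × ℤ)) (K : Set (ℝ × ℝ)) : Prop :=
  2 ≤ n ∧ D ⊆ Set.Icc (0, 0) ((n : ℤ) - 1, (n : ℤ) - 1) ∧
  1 < Nat.card D ∧ Nat.card D < n ^ 2 ∧
  K.Nonempty ∧ IsCompact K ∧
  K = ⋃ d ∈ D, pieceMap n d '' K

/-- A dendrite: a nonempty compact, connected, locally connected (planar) set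
containing no subset homeomorphic to the circle. -/
def IsDendrite (K : Set (ℝ × ℝ)) : Prop :=
  K.Nonempty ∧ IsCompact K ∧ IsConnected K ∧ LocallyConnectedSpace K ∧
  ¬ ∃ S : Set (ℝ × ℝ), S ⊆ K ∧ Nonempty (S ≃ₜ Circle)

/-- Closed subsets of `[0,1]` all of whose gaps are closed loops of `f`. -/
def GapSet {X : Type*} (f : ℝ → X) (C : Set ℝ) : Prop :=
  IsClosed C ∧ C ⊆ Icc 0 1 ∧ (0:ℝ) ∈ C ∧ (1:ℝ) ∈ C ∧
    ∀ a ∈ C, ∀ b ∈ C, a < b → (∀ c ∈ C, ¬ (a < c ∧ c < b)) → f a = f b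

lemma exists_gap {C : Set ℝ} (hC : IsClosed C) {a b p : ℝ} (ha : a ∈ C) (hb : b ∈ C)
    (hp : p ∉ C) (hap : a < p) (hpb : p < b) :
    ∃ a' ∈ C, ∃ b' ∈ C, a ≤ a' ∧ a' < p ∧ p < b' ∧ b' ≤ b ∧ ∀ c ∈ C, ¬ (a' < c ∧ c < b') := by
  have h1 : IsCompact (C ∩ Icc a p) := isCompact_Icc.inter_left hC
  have h2 : IsCompact (C ∩ Icc p b) := isCompact_Icc.inter_left hC
  obtain ⟨a', ha', hma⟩ := h1.exists_isGreatest ⟨a, ha, le_refl _, hap.le⟩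
  obtain ⟨b', hb', hmb⟩ := h2.exists_isLeast ⟨b, hb, hpb.le, le_refl _⟩
  have h3 : a' < p := lt_of_le_of_ne ha'.2.2 (fun h => hp (h ▸ ha'.1))
  have h4 : p < b' := lt_of_le_of_ne hb'.2.1 (fun h => hp (h ▸ hb'.1))
  refine ⟨a', ha'.1, b', hb'.1, ha'.2.1, h3, h4, hb'.2.2, ?_⟩
  rintro c hc ⟨hc1, hc2⟩
  rcases le_total c p with h | h
  · exact absurd (hma ⟨hc, ha'.2.1.trans hc1.le, h⟩) (not_le.2 hc1)
  · exact absurd (hmb ⟨hc, h, hc2.le.trans hb'.2.2⟩) (not_le.2 hc2)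

lemma exists_minimal_gapSet {X : Type*} [MetricSpace X] (f : ℝ → X) (hf : Continuous f) :
    ∃ C, Minimal (GapSet f) C := by
  have h := zorn_superset_nonempty {C | GapSet f C} ?_ (Icc 0 1) ?_
  · obtain ⟨m, _, hm⟩ := h
    exact ⟨m, hm⟩
  · intro c hc hchain hne
    refine ⟨⋂₀ c, ?_, fun s hs => sInter_subset_of_mem hs⟩
    obtain ⟨C0, hC0⟩ := hne
    refine ⟨isClosed_sInter fun s hs => (hc hs).1, (sInter_subset_of_mem hC0).trans (hc hC0).2.1,
      fun s hs => (hc hs).2.2.1, fun s hs => (hc hs).2.2.2.1, ?_⟩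
    intro a ha b hb hab hgap
    by_contra hne
    have hε : 0 < dist (f a) (f b) / 2 := half_pos (dist_pos.2 hne)
    obtain ⟨δ1, hδ1, h1⟩ := Metric.continuous_iff.1 hf a _ hε
    obtain ⟨δ2, hδ2, h2⟩ := Metric.continuous_iff.1 hf b _ hε
    set δ := min (min δ1 δ2) (b - a) / 3 with hδ
    have hδ0 : 0 < δ := by
      have : 0 < b - a := sub_pos.2 hab
      positivity
    have hδa : δ < δ1 := by
      have := min_le_left (min δ1 δ2) (b-a)
      have := min_le_left δ1 δ2
      linarith
    have hδb : δ < δ2 := by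
      have := min_le_left (min δ1 δ2) (b-a)
      have := min_le_right δ1 δ2
      linarith
    have hδc : 3 * δ ≤ b - a := by
      have := min_le_right (min δ1 δ2) (b-a)
      linarith
    have hK : ∃ C ∈ c, Icc (a + δ) (b - δ) ∩ C = ∅ := by
      have : Nonempty c := ⟨⟨C0, hC0⟩⟩
      obtain ⟨C, hC⟩ := (isCompact_Icc (a := a + δ) (b := b - δ)).elim_directed_family_closed
        (fun s : c => (s : Set ℝ)) (fun s => (hc s.2).1) (by
          rw [← sInter_eq_iInter, eq_empty_iff_forall_notMem]
          rintro x ⟨hx1, hx2⟩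
          exact hgap x hx2 ⟨by linarith [hx1.1], by linarith [hx1.2]⟩)
        (by
          intro x y
          rcases hchain.total x.2 y.2 with h | h
          · exact ⟨x, subset_rfl, h⟩
          · exact ⟨y, h, subset_rfl⟩)
      exact ⟨C, C.2, hC⟩
    obtain ⟨C, hCc, hC⟩ := hK
    have hno : ∀ x ∈ C, ¬ (a + δ ≤ x ∧ x ≤ b - δ) := fun x hx hx' => by
      have : x ∈ Icc (a + δ) (b - δ) ∩ C := ⟨hx', hx⟩
      rw [hC] at this
      exact this
    obtain ⟨a', ha', b', hb', h3, h4, h5, h6, h7⟩ := exists_gap (hc hCc).1 (ha C hCc) (hb C hCc)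
      (p := a + δ) (fun h => hno _ h ⟨le_refl _, by linarith⟩) (by linarith) (by linarith)
    have h8 : b - δ < b' := by
      by_contra h
      exact hno b' hb' ⟨h5.le, not_lt.1 h⟩
    have e := (hc hCc).2.2.2.2 a' ha' b' hb' (h4.trans h5) h7
    have d1 := h1 a' (by rw [Real.dist_eq, abs_of_nonneg] <;> linarith)
    have d2 := h2 b' (by rw [Real.dist_eq, abs_of_nonpos] <;> linarith)
    have := dist_triangle (f a) (f a') (f b)
    rw [dist_comm (f a) (f a')] at this
    rw [e] at this d1
    linarith
  · refine ⟨isClosed_Icc, subset_rfl, by simp, by simp, ?_⟩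
    intro a ha b hb hab h
    exact absurd ⟨by linarith, by linarith⟩ (h ((a+b)/2) ⟨by linarith [ha.1, hb.1], by linarith [ha.2, hb.2]⟩)

lemma minimal_gapSet_inj {X : Type*} [MetricSpace X] {f : ℝ → X} {C : Set ℝ}
    (hC : Minimal (GapSet f) C) {s t : ℝ} (hs : s ∈ C) (ht : t ∈ C) (_hst : s < t)
    (e : f s = f t) : ∀ c ∈ C, ¬ (s < c ∧ c < t) := by
  obtain ⟨h1, h2, h3, h4, h5⟩ := hC.prop
  have : GapSet f (C \ Ioo s t) := by
    refine ⟨h1.sdiff isOpen_Ioo, sdiff_subset.trans h2, ⟨h3, fun h => ?_⟩, ⟨h4, fun h => ?_⟩, ?_⟩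
    · exact absurd h.1 (not_lt.2 (h2 hs).1)
    · exact absurd h.2 (not_lt.2 (h2 ht).2)
    · rintro a ⟨ha, ha'⟩ b ⟨hb, hb'⟩ hab hg
      by_cases hh : ∀ c ∈ C, ¬ (a < c ∧ c < b)
      · exact h5 a ha b hb hab hh
      · push Not at hh
        obtain ⟨c, hc, hc1, hc2⟩ := hh
        have hc3 : c ∈ Ioo s t := by
          by_contra h
          exact hg c ⟨hc, h⟩ ⟨hc1, hc2⟩
        have k1 := hg s ⟨hs, by simp⟩
        have k2 := hg t ⟨ht, by simp⟩
        simp only [mem_Ioo] at *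
        have e1 : a = s := by grind
        have e2 : b = t := by grind
        rw [e1, e2, e]
  intro c hc hcc
  exact (hC.le_of_le this sdiff_subset hc).2 hcc

lemma infDist_initial_continuousOn {X : Type*} [MetricSpace X] {f : ℝ → X} (hf : Continuous f)
    {C : Set ℝ} (hC : C ⊆ Icc 0 1) (x : X) :
    ContinuousOn (fun t => Metric.infDist x (f '' (C ∩ Iic t))) C := by
  rw [Metric.continuousOn_iff]
  intro b hb ε hε
  have hu := (isCompact_Icc (a := (0:ℝ)) (b := 1)).uniformContinuousOn_of_continuous hf.continuousOn
  rw [Metric.uniformContinuousOn_iff] at hu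
  obtain ⟨δ, hδ, h⟩ := hu (ε / 2) (half_pos hε)
  have key : ∀ s ∈ C, ∀ t ∈ C, s ≤ t → dist s t < δ →
      dist (Metric.infDist x (f '' (C ∩ Iic s))) (Metric.infDist x (f '' (C ∩ Iic t))) < ε := by
    intro s hs t ht hst hd
    have hne : (f '' (C ∩ Iic s)).Nonempty := ⟨f s, s, ⟨hs, mem_Iic.2 le_rfl⟩, rfl⟩
    have hne' : (f '' (C ∩ Iic t)).Nonempty := ⟨f t, t, ⟨ht, mem_Iic.2 le_rfl⟩, rfl⟩
    have h1 : Metric.infDist x (f '' (C ∩ Iic t)) ≤ Metric.infDist x (f '' (C ∩ Iic s)) :=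
      Metric.infDist_le_infDist_of_subset
        (image_mono (inter_subset_inter_right _ (Iic_subset_Iic.2 hst))) hne
    have h2 : Metric.infDist x (f '' (C ∩ Iic s)) - ε / 2 ≤ Metric.infDist x (f '' (C ∩ Iic t)) := by
      rw [Metric.le_infDist hne']
      rintro _ ⟨r, ⟨hr, hrt⟩, rfl⟩
      simp only [mem_Iic] at hrt
      rcases le_total r s with hrs | hrs
      · have : Metric.infDist x (f '' (C ∩ Iic s)) ≤ dist x (f r) :=
          Metric.infDist_le_dist_of_mem ⟨r, ⟨hr, hrs⟩, rfl⟩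
        linarith
      · have h3 : Metric.infDist x (f '' (C ∩ Iic s)) ≤ dist x (f s) :=
          Metric.infDist_le_dist_of_mem ⟨s, ⟨hs, mem_Iic.2 le_rfl⟩, rfl⟩
        have h4 := h r (hC hr) s (hC hs) (by
          rw [Real.dist_eq, abs_of_nonpos (by linarith)] at hd
          rw [Real.dist_eq, abs_of_nonneg (by linarith)]
          linarith)
        have := dist_triangle x (f r) (f s)
        linarith
    rw [Real.dist_eq, abs_of_nonneg (by linarith)]
    linarith
  refine ⟨δ, hδ, fun a ha hab => ?_⟩
  rcases le_total a b with hh | hh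
  · exact key a ha b hb hh hab
  · rw [dist_comm]
    exact key b hb a ha hh (by rwa [dist_comm])

lemma exists_height {X : Type*} [MetricSpace X] [TopologicalSpace.SeparableSpace X]
    {f : ℝ → X} (hf : Continuous f) {C : Set ℝ} (hC : Minimal (GapSet f) C) :
    ∃ h : ℝ → ℝ, ContinuousOn h C ∧ MonotoneOn h C ∧
      ∀ s ∈ C, ∀ t ∈ C, (h s = h t ↔ f s = f t) := by
  have hne : Nonempty X := ⟨f 0⟩
  obtain ⟨hcl, hsub, h0, h1, hgap⟩ := hC.prop
  let x := TopologicalSpace.denseSeq X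
  let ψ : ℕ → ℝ → ℝ := fun k t => Metric.infDist (x k) (f '' (C ∩ Iic t))
  let φ : ℕ → ℝ → ℝ := fun k t => (1/2)^k * min 1 (ψ k t)
  have hψ0 : ∀ k t, 0 ≤ ψ k t := fun k t => Metric.infDist_nonneg
  have hψ : ∀ k, ∀ s ∈ C, ∀ t, s ≤ t → ψ k t ≤ ψ k s := fun k s hs t hst =>
    Metric.infDist_le_infDist_of_subset
        (image_mono (inter_subset_inter_right _ (Iic_subset_Iic.2 hst))) ⟨f s, s, ⟨hs, mem_Iic.2 le_rfl⟩, rfl⟩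
  have hφ : ∀ k, ∀ s ∈ C, ∀ t, s ≤ t → φ k t ≤ φ k s := fun k s hs t hst =>
    mul_le_mul_of_nonneg_left (min_le_min_left _ (hψ k s hs t hst)) (by positivity)
  have hb : ∀ k t, ‖φ k t‖ ≤ (1/2)^k := fun k t => by
    have h1 : 0 ≤ min 1 (ψ k t) := le_min zero_le_one (hψ0 k t)
    rw [Real.norm_of_nonneg (by positivity)]
    exact mul_le_of_le_one_right (by positivity) (min_le_left _ _)
  have hsg : Summable (fun k : ℕ => ((1:ℝ)/2)^k) := summable_geometric_two
  have hsum : ∀ t, Summable (fun k => φ k t) := fun t => Summable.of_norm_bounded hsg (fun k => hb k t)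
  have hmono : ∀ s ∈ C, ∀ t, s ≤ t → ∑' k, φ k t ≤ ∑' k, φ k s := fun s hs t hst =>
    (hsum t).tsum_le_tsum (fun k => hφ k s hs t hst) (hsum s)
  have key : ∀ s ∈ C, ∀ t ∈ C, s < t → ((∑' k, φ k s = ∑' k, φ k t) ↔ f s = f t) := by
    intro s hs t ht hst
    constructor
    · intro he
      have hterm : ∀ k, φ k t = φ k s := by
        intro k
        by_contra hk
        have := (hsum t).tsum_lt_tsum (i := k) (fun k => hφ k s hs t hst.le)
          (lt_of_le_of_ne (hφ k s hs t hst.le) hk) (hsum s)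
        linarith
      have hcomp : IsCompact (f '' (C ∩ Iic s)) := by
        apply IsCompact.image _ hf
        apply IsCompact.inter_right _ isClosed_Iic
        exact isCompact_Icc.of_isClosed_subset hcl hsub
      have hmem : f t ∈ f '' (C ∩ Iic s) := by
        rw [← hcomp.isClosed.closure_eq, Metric.mem_closure_iff]
        intro ε hε
        have hδ : 0 < min (ε / 2) (1/2) := by positivity
        obtain ⟨k, hk⟩ := (TopologicalSpace.denseRange_denseSeq X).exists_dist_lt (f t) hδ
        have h1 : ψ k t ≤ dist (x k) (f t) :=
          Metric.infDist_le_dist_of_mem ⟨t, ⟨ht, mem_Iic.2 le_rfl⟩, rfl⟩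
        rw [dist_comm] at hk
        have h2 : min 1 (ψ k t) = min 1 (ψ k s) := by
          have := hterm k
          exact mul_left_cancel₀ (by positivity) this
        have h3 : ψ k t < 1/2 := h1.trans_lt (hk.trans_le (min_le_right _ _))
        rw [min_eq_right (by linarith)] at h2
        have h4 : ψ k s = ψ k t := by
          rcases min_cases 1 (ψ k s) with h | h
          · rw [h.1] at h2; linarith
          · rw [h.1] at h2; exact h2.symm
        have h5 : ψ k s < ε / 2 := h4 ▸ h1.trans_lt (hk.trans_le (min_le_left _ _))
        have hS : (f '' (C ∩ Iic s)).Nonempty := ⟨f s, s, ⟨hs, mem_Iic.2 le_rfl⟩, rfl⟩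
        obtain ⟨y, hy, hyd⟩ := (Metric.infDist_lt_iff hS).1 h5
        refine ⟨y, hy, ?_⟩
        have h6 := dist_triangle_left (f t) y (x k)
        have h7 := hk.trans_le (min_le_left _ _)
        have h8 : dist (x k) (f t) < ε / 2 := h7
        linarith
      obtain ⟨r, ⟨hr, hrs⟩, he⟩ := hmem
      simp only [mem_Iic] at hrs
      have := minimal_gapSet_inj hC hr ht (by linarith) he s hs
      have : r = s := by grind
      rw [← this, he]
    · intro he
      have hg := minimal_gapSet_inj hC hs ht hst he
      have : f '' (C ∩ Iic t) = f '' (C ∩ Iic s) := by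
        apply Subset.antisymm
        · rintro _ ⟨r, ⟨hr, hrt⟩, rfl⟩
          simp only [mem_Iic] at hrt
          by_cases hrs : r ≤ s
          · exact ⟨r, ⟨hr, hrs⟩, rfl⟩
          · have : r = t := by
              have := hg r hr
              grind
            exact ⟨s, ⟨hs, mem_Iic.2 le_rfl⟩, by rw [this, he]⟩
        · exact image_mono (inter_subset_inter_right _ (Iic_subset_Iic.2 hst.le))
      simp only [φ, ψ, this]
  refine ⟨fun t => - ∑' k, φ k t, ?_, ?_, ?_⟩
  · apply ContinuousOn.neg
    apply continuousOn_tsum (u := fun k => (1/2)^k) _ hsg (fun k t _ => hb k t)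
    intro k
    exact continuousOn_const.mul (ContinuousOn.inf continuousOn_const (infDist_initial_continuousOn hf hsub (x k)))
  · intro s hs t _ hst
    exact neg_le_neg (hmono s hs t hst)
  · intro s hs t ht
    rw [neg_inj]
    rcases lt_trichotomy s t with h | h | h
    · exact key s hs t ht h
    · simp [h]
    · rw [eq_comm, key t ht s hs h, eq_comm]

lemma exists_arc {X : Type*} [MetricSpace X] [TopologicalSpace.SeparableSpace X]
    {f : ℝ → X} (hf : Continuous f) (hne : f 0 ≠ f 1) :
    ∃ γ : ℝ → X, ContinuousOn γ (Icc 0 1) ∧ InjOn γ (Icc 0 1) ∧ γ 0 = f 0 ∧ γ 1 = f 1 ∧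
      ∀ t ∈ Icc (0:ℝ) 1, γ t ∈ f '' Icc 0 1 := by
  obtain ⟨C, hC⟩ := exists_minimal_gapSet f hf
  obtain ⟨h, hcont, hmono, hiff⟩ := exists_height hf hC
  obtain ⟨hcl, hsub, h0, h1, hgap⟩ := hC.prop
  have hcomp : IsCompact C := isCompact_Icc.of_isClosed_subset hcl hsub
  have hlt : h 0 < h 1 := lt_of_le_of_ne (hmono h0 h1 zero_le_one) (fun e => hne ((hiff 0 h0 1 h1).1 e))
  have hsurj : ∀ v ∈ Icc (h 0) (h 1), ∃ t ∈ C, h t = v := by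
    intro v hv
    by_contra hcon
    push Not at hcon
    -- greatest point of C with h ≤ v, least with v ≤ h
    have c1 : IsCompact (C ∩ h ⁻¹' Iic v) :=
      hcomp.of_isClosed_subset (hcont.preimage_isClosed_of_isClosed hcl isClosed_Iic) inter_subset_left
    have c2 : IsCompact (C ∩ h ⁻¹' Ici v) :=
      hcomp.of_isClosed_subset (hcont.preimage_isClosed_of_isClosed hcl isClosed_Ici) inter_subset_left
    obtain ⟨a, ha, hma⟩ := c1.exists_isGreatest ⟨0, h0, hv.1⟩
    obtain ⟨b, hb, hmb⟩ := c2.exists_isLeast ⟨1, h1, hv.2⟩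
    have ha2 : h a < v := lt_of_le_of_ne ha.2 (hcon a ha.1)
    have hb2 : v < h b := lt_of_le_of_ne hb.2 (hcon b hb.1).symm
    have hab : a < b := by
      by_contra hh
      have := hmono hb.1 ha.1 (not_lt.1 hh)
      linarith
    have := hgap a ha.1 b hb.1 hab (by
      rintro c hc ⟨hc1, hc2⟩
      rcases le_total (h c) v with hh | hh
      · exact absurd (hma ⟨hc, hh⟩) (not_le.2 hc1)
      · exact absurd (hmb ⟨hc, hh⟩) (not_le.2 hc2))
    rw [← hiff a ha.1 b hb.1] at this
    linarith
  have haff : ∀ t ∈ Icc (0:ℝ) 1, h 0 + t * (h 1 - h 0) ∈ Icc (h 0) (h 1) := fun t ht =>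
    ⟨by nlinarith [ht.1], by nlinarith [ht.2]⟩
  choose! g hgC hg using hsurj
  have cont : ContinuousOn (fun v => f (g v)) (Icc (h 0) (h 1)) := by
    rw [continuousOn_iff_isClosed]
    intro F hF
    refine ⟨h '' (C ∩ f ⁻¹' F), ?_, ?_⟩
    · apply IsCompact.isClosed
      apply IsCompact.image_of_continuousOn (hcomp.inter_right (hF.preimage hf))
      exact hcont.mono inter_subset_left
    · ext v
      constructor
      · rintro ⟨hv1, hv2⟩
        exact ⟨⟨g v, ⟨hgC v hv2, hv1⟩, hg v hv2⟩, hv2⟩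
      · rintro ⟨⟨t, ⟨ht, htF⟩, rfl⟩, hv2⟩
        refine ⟨?_, hv2⟩
        have : f (g (h t)) = f t := (hiff _ (hgC _ hv2) _ ht).1 (hg _ hv2)
        simp only [mem_preimage, this]
        exact htF
  have hgh : ∀ t ∈ C, h t ∈ Icc (h 0) (h 1) → f (g (h t)) = f t := fun t ht hv =>
    (hiff _ (hgC _ hv) _ ht).1 (hg _ hv)
  refine ⟨fun t => f (g (h 0 + t * (h 1 - h 0))), ?_, ?_, ?_, ?_, ?_⟩
  · exact cont.comp (by fun_prop) haff
  · intro s hs t ht hst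
    have := (hiff _ (hgC _ (haff s hs)) _ (hgC _ (haff t ht))).2 hst
    rw [hg _ (haff s hs), hg _ (haff t ht)] at this
    have h3 : h 1 - h 0 ≠ 0 := by linarith
    exact mul_right_cancel₀ h3 (add_left_cancel this)
  · simp only [zero_mul, add_zero]
    exact hgh 0 h0 ⟨le_refl _, hlt.le⟩
  · simp only [one_mul, add_sub_cancel]
    exact hgh 1 h1 ⟨hlt.le, le_refl _⟩
  · intro t ht
    exact ⟨_, hsub (hgC _ (haff t ht)), rfl⟩

lemma circle_of_loop {X : Type*} [MetricSpace X] {F : ℝ → X}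
    (hF : ContinuousOn F (Icc 0 2)) (hinj : InjOn F (Ico 0 2)) (he : F 0 = F 2) :
    Nonempty (F '' Ico 0 2 ≃ₜ Circle) := by
  have : Fact ((0:ℝ) < 2) := ⟨by norm_num⟩
  let G : AddCircle (2:ℝ) → X := AddCircle.liftIco 2 0 F
  have hG : Continuous G := AddCircle.liftIco_zero_continuous he hF
  have hrep : ∀ z : AddCircle (2:ℝ), ∃ t ∈ Ico (0:ℝ) 2, (t : AddCircle (2:ℝ)) = z ∧ G z = F t := by
    intro z
    obtain ⟨t, ht, rfl⟩ : ∃ t ∈ Ico (0:ℝ) 2, (t : AddCircle (2:ℝ)) = z := by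
      have h1 := (AddCircle.equivIco 2 0 z).2
      refine ⟨(AddCircle.equivIco 2 0 z : ℝ), by simpa using h1, ?_⟩
      exact (AddCircle.equivIco 2 0).symm_apply_apply z
    exact ⟨t, ht, rfl, AddCircle.liftIco_zero_coe_apply ht⟩
  have hGinj : Function.Injective G := by
    intro z w hzw
    obtain ⟨t, ht, rfl, h1⟩ := hrep z
    obtain ⟨s, hs, rfl, h2⟩ := hrep w
    rw [h1, h2] at hzw
    rw [hinj ht hs hzw]
  have hrange : range G = F '' Ico 0 2 := by
    ext y
    constructor
    · rintro ⟨z, rfl⟩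
      obtain ⟨t, ht, _, h⟩ := hrep z
      exact ⟨t, ht, h.symm⟩
    · rintro ⟨t, ht, rfl⟩
      exact ⟨t, AddCircle.liftIco_zero_coe_apply ht⟩
  have hemb : Topology.IsClosedEmbedding G := hG.isClosedEmbedding hGinj
  rw [← hrange]
  exact ⟨hemb.isEmbedding.toHomeomorph.symm.trans (AddCircle.homeomorphCircle (by norm_num))⟩

lemma arc_subset_arc {X : Type*} [MetricSpace X] {K : Set X}
    (hK : ¬ ∃ S : Set X, S ⊆ K ∧ Nonempty (S ≃ₜ Circle)) {γ δ : ℝ → X}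
    (hγ : ContinuousOn γ (Icc 0 1)) (hγi : InjOn γ (Icc 0 1)) (hγK : ∀ t ∈ Icc (0:ℝ) 1, γ t ∈ K)
    (hδ : ContinuousOn δ (Icc 0 1)) (hδi : InjOn δ (Icc 0 1)) (hδK : ∀ t ∈ Icc (0:ℝ) 1, δ t ∈ K)
    (e0 : γ 0 = δ 0) (e1 : γ 1 = δ 1) :
    ∀ t ∈ Icc (0:ℝ) 1, γ t ∈ δ '' Icc 0 1 := by
  intro p hp
  by_contra hcon
  apply hK
  have hcl : IsClosed (Icc 0 1 ∩ γ ⁻¹' (δ '' Icc 0 1)) :=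
    hγ.preimage_isClosed_of_isClosed isClosed_Icc (isCompact_Icc.image_of_continuousOn hδ).isClosed
  have m0 : (0:ℝ) ∈ Icc 0 1 ∩ γ ⁻¹' (δ '' Icc 0 1) := ⟨by simp, 0, by simp, e0.symm⟩
  have m1 : (1:ℝ) ∈ Icc 0 1 ∩ γ ⁻¹' (δ '' Icc 0 1) := ⟨by simp, 1, by simp, e1.symm⟩
  have hp0 : 0 < p := lt_of_le_of_ne hp.1 (fun h => hcon (h ▸ m0.2))
  have hp1 : p < 1 := lt_of_le_of_ne hp.2 (fun h => hcon (h ▸ m1.2))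
  obtain ⟨a, ⟨haI, a', ha', hea⟩, b, ⟨hbI, b', hb', heb⟩, _, hap, hpb, _, hg⟩ :=
    exists_gap hcl m0 m1 (fun h => hcon h.2) hp0 hp1
  have hab : a < b := hap.trans hpb
  have hne : b' ≠ a' := by
    rintro rfl
    exact hab.ne (hγi haI hbI (hea.symm.trans heb))
  let F : ℝ → X := fun t => if t ≤ 1 then γ (a + t * (b - a)) else δ (b' + (t - 1) * (a' - b'))
  have r1 : ∀ t ∈ Icc (0:ℝ) 1, a + t * (b - a) ∈ Icc a b := fun t ht =>
    ⟨by nlinarith [ht.1], by nlinarith [ht.2]⟩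
  have r1' : ∀ t ∈ Icc (0:ℝ) 1, a + t * (b - a) ∈ Icc (0:ℝ) 1 := fun t ht =>
    ⟨haI.1.trans (r1 t ht).1, (r1 t ht).2.trans hbI.2⟩
  have r2 : ∀ t ∈ Icc (1:ℝ) 2, b' + (t - 1) * (a' - b') ∈ Icc (0:ℝ) 1 := fun t ht => by
    have := (convex_Icc (0:ℝ) 1) hb' ha' (a := 1 - (t-1)) (b := t - 1) (by linarith [ht.2])
      (by linarith [ht.1]) (by ring)
    simp only [smul_eq_mul] at this
    convert this using 1
    ring
  have hFc : ContinuousOn F (Icc 0 2) := by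
    have e : Icc (0:ℝ) 2 = Icc 0 1 ∪ Icc 1 2 := (Icc_union_Icc_eq_Icc (by norm_num) (by norm_num)).symm
    rw [e]
    refine ContinuousOn.union_of_isClosed ?_ ?_ isClosed_Icc isClosed_Icc
    · have : ContinuousOn (fun t => γ (a + t * (b - a))) (Icc 0 1) := hγ.comp (by fun_prop) r1'
      exact this.congr (fun t ht => if_pos ht.2)
    · have : ContinuousOn (fun t => δ (b' + (t - 1) * (a' - b'))) (Icc 1 2) := hδ.comp (by fun_prop) r2
      refine this.congr (fun t ht => ?_)
      by_cases h : t ≤ 1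
      · have : t = 1 := le_antisymm h ht.1
        subst this
        simp only [F, le_refl, if_true]
        simp [heb]
      · exact if_neg h
  have hFe : F 0 = F 2 := by
    simp only [F]
    norm_num
    exact hea.symm
  have cross : ∀ s ∈ Ico (0:ℝ) 2, ∀ t ∈ Ico (0:ℝ) 2, s ≤ 1 → ¬ t ≤ 1 → F s ≠ F t := by
    intro s hs t ht hs1 ht1 h
    have hF1 : F s = γ (a + s * (b - a)) := if_pos hs1
    have hF2 : F t = δ (b' + (t - 1) * (a' - b')) := if_neg ht1
    have hsI : s ∈ Icc (0:ℝ) 1 := ⟨hs.1, hs1⟩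
    have htI : t ∈ Icc (1:ℝ) 2 := ⟨(not_le.1 ht1).le, ht.2.le⟩
    rw [hF1, hF2] at h
    have hd := hg _ ⟨r1' s hsI, _, r2 t htI, h.symm⟩
    have : a + s * (b - a) = a ∨ a + s * (b - a) = b := by
      have := r1 s hsI
      simp only [mem_Icc] at this
      grind
    have h3 : a' - b' ≠ 0 := sub_ne_zero.2 hne.symm
    rcases this with h2 | h2
    · rw [h2, ← hea] at h
      have := hδi ha' (r2 t htI) h
      have h4 : (t - 2) * (a' - b') = 0 := by linarith
      rcases mul_eq_zero.1 h4 with h5 | h5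
      · linarith [ht.2]
      · exact h3 h5
    · rw [h2, ← heb] at h
      have := hδi hb' (r2 t htI) h
      have h4 : (t - 1) * (a' - b') = 0 := by linarith
      rcases mul_eq_zero.1 h4 with h5 | h5
      · exact ht1 (by linarith)
      · exact h3 h5
  have hFi : InjOn F (Ico 0 2) := by
    intro s hs t ht h
    by_cases hs1 : s ≤ 1 <;> by_cases ht1 : t ≤ 1
    · have hF1 : F s = γ (a + s * (b - a)) := if_pos hs1
      have hF2 : F t = γ (a + t * (b - a)) := if_pos ht1
      rw [hF1, hF2] at h
      have := hγi (r1' s ⟨hs.1, hs1⟩) (r1' t ⟨ht.1, ht1⟩) h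
      exact mul_right_cancel₀ (sub_ne_zero.2 hab.ne') (add_left_cancel this)
    · exact absurd h (cross s hs t ht hs1 ht1)
    · exact absurd h.symm (cross t ht s hs ht1 hs1)
    · have hF1 : F s = δ (b' + (s - 1) * (a' - b')) := if_neg hs1
      have hF2 : F t = δ (b' + (t - 1) * (a' - b')) := if_neg ht1
      rw [hF1, hF2] at h
      have := hδi (r2 s ⟨(not_le.1 hs1).le, hs.2.le⟩) (r2 t ⟨(not_le.1 ht1).le, ht.2.le⟩) h
      have := mul_right_cancel₀ (sub_ne_zero.2 hne.symm) (add_left_cancel this)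
      linarith
  refine ⟨F '' Ico 0 2, ?_, circle_of_loop hFc hFi hFe⟩
  rintro _ ⟨t, ht, rfl⟩
  by_cases ht1 : t ≤ 1
  · have hF1 : F t = γ (a + t * (b - a)) := if_pos ht1
    rw [hF1]
    exact hγK _ (r1' t ⟨ht.1, ht1⟩)
  · have hF2 : F t = δ (b' + (t - 1) * (a' - b')) := if_neg ht1
    rw [hF2]
    exact hδK _ (r2 t ⟨(not_le.1 ht1).le, ht.2.le⟩)

lemma JoinedIn.exists_arc {X : Type*} [MetricSpace X] [TopologicalSpace.SeparableSpace X]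
    {A : Set X} {x y : X} (h : JoinedIn A x y) (hxy : x ≠ y) :
    ∃ γ : ℝ → X, ContinuousOn γ (Icc 0 1) ∧ InjOn γ (Icc 0 1) ∧ γ 0 = x ∧ γ 1 = y ∧
      ∀ t ∈ Icc (0:ℝ) 1, γ t ∈ A := by
  obtain ⟨p, hp⟩ := h
  obtain ⟨γ, h1, h2, h3, h4, h5⟩ := _root_.exists_arc p.continuous_extend (by simpa using hxy)
  refine ⟨γ, h1, h2, by simpa using h3, by simpa using h4, fun t ht => ?_⟩
  obtain ⟨s, hs, hst⟩ := h5 t ht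
  rw [← hst, Path.extend_apply p hs]
  exact hp _

lemma JoinedIn.inter_of_no_circle {X : Type*} [MetricSpace X] [TopologicalSpace.SeparableSpace X]
    {K A B : Set X} (hK : ¬ ∃ S : Set X, S ⊆ K ∧ Nonempty (S ≃ₜ Circle))
    (hA : A ⊆ K) (hB : B ⊆ K) {x y : X} (hxy : x ≠ y)
    (h1 : JoinedIn A x y) (h2 : JoinedIn B x y) : JoinedIn (A ∩ B) x y := by
  obtain ⟨γ, a1, a2, a3, a4, a5⟩ := h1.exists_arc hxy
  obtain ⟨δ, b1, b2, b3, b4, b5⟩ := h2.exists_arc hxy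
  have := arc_subset_arc hK a1 a2 (fun t ht => hA (a5 t ht)) b1 b2 (fun t ht => hB (b5 t ht))
    (a3.trans b3.symm) (a4.trans b4.symm)
  refine JoinedIn.ofLine a1 a3 a4 ?_
  rintro _ ⟨t, ht, rfl⟩
  refine ⟨a5 t ht, ?_⟩
  obtain ⟨s, hs, hst⟩ := this t ht
  rw [← hst]
  exact b5 s hs

lemma joinedIn_of_chains {X : Type*} [MetricSpace X] [CompleteSpace X] {K : Set X}
    (hK : IsClosed K) {m : ℕ} (hm : 2 ≤ m) {C r : ℝ} (hr0 : 0 ≤ r) (hr : r < 1)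
    {z : ℕ → ℕ → X} {p q : X}
    (h1 : ∀ k j, dist (z k j) (z k (j+1)) ≤ C * r^k)
    (h2 : ∀ k j, dist (z k (j / m)) (z (k+1) j) ≤ C * r^k)
    (h0 : ∀ k, z k 0 = p) (hq : ∀ k, z k (m^k) = q) (hz : ∀ k j, z k j ∈ K) :
    JoinedIn K p q := by
  have hm0 : (0:ℝ) < m := by positivity
  let u : ℝ → ℕ → X := fun t k => z k ⌊(m:ℝ)^k * t⌋₊
  have hu : ∀ t k, dist (u t k) (u t (k+1)) ≤ C * r^k := by
    intro t k
    have : ⌊(m:ℝ)^k * t⌋₊ = ⌊(m:ℝ)^(k+1) * t⌋₊ / m := by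
      rw [← Nat.floor_div_natCast]
      congr 1
      field_simp
      ring
    simp only [u]
    rw [this]
    exact h2 _ _
  have hlim : ∀ t, ∃ y, Filter.Tendsto (u t) Filter.atTop (nhds y) := fun t =>
    cauchySeq_tendsto_of_complete (cauchySeq_of_le_geometric r C hr (hu t))
  choose f hf using hlim
  have hd : ∀ t k, dist (u t k) (f t) ≤ C * r^k / (1 - r) := fun t k =>
    dist_le_of_le_geometric_of_tendsto r C hr (hu t) (hf t) k
  have hC : 0 ≤ C := by
    have := h1 0 0
    simp only [pow_zero, mul_one] at this
    exact dist_nonneg.trans this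
  have hstep : ∀ k s t, s ≤ t → (m:ℝ)^k * (t - s) < 1 → dist (u s k) (u t k) ≤ C * r^k := by
    intro k s t hst hlt
    have hle : ⌊(m:ℝ)^k * s⌋₊ ≤ ⌊(m:ℝ)^k * t⌋₊ := Nat.floor_mono (by gcongr)
    have hle2 : ⌊(m:ℝ)^k * t⌋₊ ≤ ⌊(m:ℝ)^k * s⌋₊ + 1 := by
      have h3 : (m:ℝ)^k * s < ⌊(m:ℝ)^k * s⌋₊ + 1 := Nat.lt_floor_add_one _
      have h4 : (m:ℝ)^k * t < ((⌊(m:ℝ)^k * s⌋₊ + 2 : ℕ) : ℝ) := by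
        push_cast
        linarith
      have := (Nat.floor_lt' (by omega)).2 h4
      omega
    have : ⌊(m:ℝ)^k * t⌋₊ = ⌊(m:ℝ)^k * s⌋₊ ∨ ⌊(m:ℝ)^k * t⌋₊ = ⌊(m:ℝ)^k * s⌋₊ + 1 := by omega
    simp only [u]
    rcases this with h | h
    · rw [h, dist_self]
      positivity
    · rw [h]
      exact h1 _ _
  have hcont : Continuous f := by
    rw [Metric.continuous_iff]
    intro b ε hε
    have htend : Filter.Tendsto (fun k : ℕ => 2 * (C * r^k / (1 - r)) + C * r^k) Filter.atTop (nhds 0) := by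
      have h := tendsto_pow_atTop_nhds_zero_of_lt_one hr0 hr
      have := ((h.const_mul C).div_const (1 - r)).const_mul 2 |>.add (h.const_mul C)
      simpa using this
    obtain ⟨k, hk⟩ := (htend.eventually (gt_mem_nhds hε)).exists
    have key : ∀ s t, s ≤ t → (m:ℝ)^k * (t - s) < 1 → dist (f s) (f t) < ε := by
      intro s t hst hlt
      have e1 := hd s k
      have e2 := hd t k
      have e3 := hstep k s t hst hlt
      have e4 := dist_triangle4 (f s) (u s k) (u t k) (f t)
      rw [dist_comm (f s) (u s k)] at e4
      linarith
    refine ⟨((m:ℝ)^k)⁻¹, by positivity, fun a hab => ?_⟩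
    have hab' : (m:ℝ)^k * |a - b| < 1 := by
      rw [Real.dist_eq] at hab
      have := mul_lt_mul_of_pos_left hab (show (0:ℝ) < (m:ℝ)^k by positivity)
      rwa [mul_inv_cancel₀ (by positivity)] at this
    rcases le_total a b with h | h
    · apply key a b h
      rwa [abs_of_nonpos (by linarith), neg_sub] at hab'
    · rw [dist_comm]
      apply key b a h
      rwa [abs_of_nonneg (by linarith)] at hab'
  refine JoinedIn.ofLine hcont.continuousOn ?_ ?_ ?_
  · refine tendsto_nhds_unique (hf 0) ?_
    simp [u, h0]
  · refine tendsto_nhds_unique (hf 1) ?_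
    have : ∀ k, u 1 k = q := by
      intro k
      have : ⌊(m:ℝ)^k * 1⌋₊ = m^k := by
        rw [mul_one, ← Nat.cast_pow, Nat.floor_natCast]
      simp only [u, this, hq]
    rw [show u 1 = fun _ => q from funext this]
    exact tendsto_const_nhds
  · rintro _ ⟨t, _, rfl⟩
    exact hK.mem_of_tendsto (hf t) (Filter.Eventually.of_forall fun k => hz _ _)

/-- `p` and `q` lie in a common cell of level `k`. -/
def SameCell (n : ℕ) (D : Set (ℤ × ℤ)) (K : Set (ℝ × ℝ)) : ℕ → ℝ × ℝ → ℝ × ℝ → Prop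
  | 0, p, q => p ∈ K ∧ q ∈ K
  | k+1, p, q => ∃ d ∈ D, ∃ p' q', SameCell n D K k p' q' ∧ pieceMap n d p' = p ∧ pieceMap n d q' = q

lemma pieceMap_mem {n : ℕ} {D : Set (ℤ × ℤ)} {K : Set (ℝ × ℝ)}
    (hK : K = ⋃ d ∈ D, pieceMap n d '' K) {d : ℤ × ℤ} (hd : d ∈ D) {x : ℝ × ℝ} (hx : x ∈ K) :
    pieceMap n d x ∈ K := by
  rw [hK]
  exact mem_biUnion hd ⟨x, hx, rfl⟩

lemma exists_of_mem {n : ℕ} {D : Set (ℤ × ℤ)} {K : Set (ℝ × ℝ)}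
    (hK : K = ⋃ d ∈ D, pieceMap n d '' K) {x : ℝ × ℝ} (hx : x ∈ K) :
    ∃ d ∈ D, ∃ y ∈ K, pieceMap n d y = x := by
  rw [hK] at hx
  simpa using hx

lemma SameCell.mem {n : ℕ} {D : Set (ℤ × ℤ)} {K : Set (ℝ × ℝ)}
    (hK : K = ⋃ d ∈ D, pieceMap n d '' K) : ∀ {k p q}, SameCell n D K k p q → p ∈ K ∧ q ∈ K
  | 0, _, _, h => h
  | k+1, _, _, ⟨_, hd, _, _, h, e1, e2⟩ => by
    have := SameCell.mem hK h
    exact ⟨e1 ▸ pieceMap_mem hK hd this.1, e2 ▸ pieceMap_mem hK hd this.2⟩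

lemma SameCell.refl {n : ℕ} {D : Set (ℤ × ℤ)} {K : Set (ℝ × ℝ)}
    (hK : K = ⋃ d ∈ D, pieceMap n d '' K) : ∀ {k p}, p ∈ K → SameCell n D K k p p
  | 0, _, h => ⟨h, h⟩
  | k+1, _, h => by
    obtain ⟨d, hd, y, hy, e⟩ := exists_of_mem hK h
    exact ⟨d, hd, y, y, SameCell.refl hK hy, e, e⟩

lemma dist_pieceMap (n : ℕ) (d : ℤ × ℤ) (x y : ℝ × ℝ) :
    dist (pieceMap n d x) (pieceMap n d y) = (n:ℝ)⁻¹ * dist x y := by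
  simp [pieceMap, dist_smul₀]

lemma continuous_pieceMap (n : ℕ) (d : ℤ × ℤ) : Continuous (pieceMap n d) := by
  unfold pieceMap
  fun_prop

lemma SameCell.dist_le {n : ℕ} {D : Set (ℤ × ℤ)} {K : Set (ℝ × ℝ)} {C : ℝ}
    (hC : ∀ x ∈ K, ∀ y ∈ K, dist x y ≤ C) : ∀ {k p q}, SameCell n D K k p q →
      dist p q ≤ C * ((n:ℝ)⁻¹)^k
  | 0, _, _, h => by simpa using hC _ h.1 _ h.2
  | k+1, _, _, ⟨d, hd, p', q', h, e1, e2⟩ => by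
    have := SameCell.dist_le hC h
    rw [← e1, ← e2, dist_pieceMap, pow_succ]
    calc (n:ℝ)⁻¹ * dist p' q' ≤ (n:ℝ)⁻¹ * (C * (n:ℝ)⁻¹ ^ k) := by gcongr
      _ = _ := by ring

/-- There is a chain of `m` steps of relation `R` from `p` to `q`. -/
def HasChain {X : Type*} (R : X → X → Prop) (m : ℕ) (p q : X) : Prop :=
  ∃ w : ℕ → X, w 0 = p ∧ w m = q ∧ ∀ i < m, R (w i) (w (i+1))

lemma HasChain.snoc {X : Type*} {R : X → X → Prop} {m : ℕ} {p q r : X}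
    (h : HasChain R m p q) (hr : R q r) : HasChain R (m+1) p r := by
  obtain ⟨w, h0, h1, h2⟩ := h
  refine ⟨fun i => if i ≤ m then w i else r, by simp [h0], by simp, fun i hi => ?_⟩
  rcases Nat.lt_succ_iff_lt_or_eq.1 hi with h | h
  · simp only [h.le, if_true, Nat.succ_le_of_lt h]
    exact h2 i h
  · subst h
    simpa [h1] using hr

lemma exists_uniform_chain {n : ℕ} {D : Set (ℤ × ℤ)} {K : Set (ℝ × ℝ)} (hD : D.Finite)
    (hcomp : IsCompact K) (hconn : IsPreconnected K)
    (hK : K = ⋃ d ∈ D, pieceMap n d '' K) :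
    ∃ m, 2 ≤ m ∧ ∀ p ∈ K, ∀ q ∈ K, HasChain (SameCell n D K 1) m p q := by
  let E : ℤ × ℤ → ℤ × ℤ → Prop := fun d e => e ∈ D ∧ (pieceMap n d '' K ∩ pieceMap n e '' K).Nonempty
  have hcl : ∀ S ⊆ D, IsClosed (⋃ d ∈ S, pieceMap n d '' K) := fun S hS =>
    (hD.subset hS).isClosed_biUnion fun d _ => (hcomp.image (continuous_pieceMap n d)).isClosed
  have hreach : ∀ d ∈ D, ∀ e ∈ D, K.Nonempty → Relation.ReflTransGen E d e := by
    intro d hd e he ⟨x, hx⟩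
    by_contra hcon
    have := isPreconnected_closed_iff.1 hconn (⋃ c ∈ {c ∈ D | Relation.ReflTransGen E d c}, pieceMap n c '' K)
      (⋃ c ∈ {c ∈ D | ¬ Relation.ReflTransGen E d c}, pieceMap n c '' K)
      (hcl _ (sep_subset _ _)) (hcl _ (sep_subset _ _)) (by
        intro y hy
        obtain ⟨c, hc, z, hz, rfl⟩ := exists_of_mem hK hy
        by_cases h : Relation.ReflTransGen E d c
        · exact Or.inl (mem_biUnion (show c ∈ {c ∈ D | Relation.ReflTransGen E d c} from ⟨hc, h⟩) ⟨z, hz, rfl⟩)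
        · exact Or.inr (mem_biUnion (show c ∈ {c ∈ D | ¬ Relation.ReflTransGen E d c} from ⟨hc, h⟩) ⟨z, hz, rfl⟩))
      ⟨pieceMap n d x, pieceMap_mem hK hd hx,
        mem_biUnion (show d ∈ {c ∈ D | Relation.ReflTransGen E d c} from ⟨hd, .refl⟩) ⟨x, hx, rfl⟩⟩
      ⟨pieceMap n e x, pieceMap_mem hK he hx,
        mem_biUnion (show e ∈ {c ∈ D | ¬ Relation.ReflTransGen E d c} from ⟨he, hcon⟩) ⟨x, hx, rfl⟩⟩
    obtain ⟨y, _, hy1, hy2⟩ := this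
    simp only [mem_iUnion] at hy1 hy2
    obtain ⟨c1, hc1, hy1⟩ := hy1
    obtain ⟨c2, hc2, hy2⟩ := hy2
    exact hc2.2 (hc1.2.tail ⟨hc2.1, y, hy1, hy2⟩)
  have hone : ∀ d ∈ D, ∀ p ∈ pieceMap n d '' K, ∀ q ∈ pieceMap n d '' K, SameCell n D K 1 p q := by
    rintro d hd _ ⟨p, hp, rfl⟩ _ ⟨q, hq, rfl⟩
    exact ⟨d, hd, p, q, ⟨hp, hq⟩, rfl, rfl⟩
  have hchain : ∀ d ∈ D, ∀ e, Relation.ReflTransGen E d e → ∃ m, ∀ p ∈ pieceMap n d '' K,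
      ∀ q ∈ pieceMap n e '' K, HasChain (SameCell n D K 1) m p q := by
    intro d hd e h
    induction h with
    | refl =>
      refine ⟨1, fun p hp q hq => ⟨fun i => if i = 0 then p else q, by simp, by simp, fun i hi => ?_⟩⟩
      obtain rfl : i = 0 := by omega
      simpa using hone d hd p hp q hq
    | tail _ h2 ih =>
      obtain ⟨m, hm⟩ := ih
      obtain ⟨hc, x, hx1, hx2⟩ := h2
      exact ⟨m+1, fun p hp q hq => (hm p hp x hx1).snoc (hone _ hc x hx2 q hq)⟩
  have hev : ∀ d ∈ D, ∀ e ∈ D, ∀ᶠ m in Filter.atTop, ∀ p ∈ pieceMap n d '' K,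
      ∀ q ∈ pieceMap n e '' K, HasChain (SameCell n D K 1) m p q := by
    intro d hd e he
    rcases K.eq_empty_or_nonempty with h | h
    · simp [h]
    obtain ⟨m, hm⟩ := hchain d hd e (hreach d hd e he h)
    filter_upwards [Filter.eventually_ge_atTop m] with k hk
    induction k, hk using Nat.le_induction with
    | base => exact hm
    | succ k _ ih =>
      intro p hp q hq
      exact (ih p hp q hq).snoc (hone e he q hq q hq)
  have hev2 : ∀ᶠ m in Filter.atTop, ∀ d ∈ D, ∀ e ∈ D, ∀ p ∈ pieceMap n d '' K,
      ∀ q ∈ pieceMap n e '' K, HasChain (SameCell n D K 1) m p q := by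
    rw [Filter.eventually_all_finite hD]
    intro d hd
    rw [Filter.eventually_all_finite hD]
    exact hev d hd
  obtain ⟨m, h1, h2⟩ := (hev2.and (Filter.eventually_ge_atTop 2)).exists
  refine ⟨m, h2, fun p hp q hq => ?_⟩
  obtain ⟨d, hd, x, hx, rfl⟩ := exists_of_mem hK hp
  obtain ⟨e, he, y, hy, rfl⟩ := exists_of_mem hK hq
  exact h1 d hd e he _ ⟨x, hx, rfl⟩ _ ⟨y, hy, rfl⟩

lemma SameCell.refine {n : ℕ} {D : Set (ℤ × ℤ)} {K : Set (ℝ × ℝ)} {m : ℕ}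
    (hK : K = ⋃ d ∈ D, pieceMap n d '' K)
    (hm : ∀ p ∈ K, ∀ q ∈ K, HasChain (SameCell n D K 1) m p q) :
    ∀ k p q, SameCell n D K k p q → ∃ w : ℕ → ℝ × ℝ, w 0 = p ∧ w m = q ∧
      ∀ i < m, SameCell n D K (k+1) (w i) (w (i+1)) ∧ SameCell n D K k p (w i) := by
  intro k
  induction k with
  | zero =>
    intro p q h
    obtain ⟨w, h0, h1, h2⟩ := hm p h.1 q h.2
    exact ⟨w, h0, h1, fun i hi => ⟨h2 i hi, h.1, (SameCell.mem hK (h2 i hi)).1⟩⟩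
  | succ k ih =>
    rintro p q ⟨d, hd, p', q', h, rfl, rfl⟩
    obtain ⟨w, h0, h1, h2⟩ := ih p' q' h
    refine ⟨fun i => pieceMap n d (w i), by simp [h0], by simp [h1], fun i hi => ⟨?_, ?_⟩⟩
    · exact ⟨d, hd, _, _, (h2 i hi).1, rfl, rfl⟩
    · exact ⟨d, hd, _, _, (h2 i hi).2, rfl, rfl⟩

lemma joinedIn_fractal {n : ℕ} {D : Set (ℤ × ℤ)} {K : Set (ℝ × ℝ)} (hn : 2 ≤ n) (hD : D.Finite)
    (hcomp : IsCompact K) (hconn : IsPreconnected K)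
    (hK : K = ⋃ d ∈ D, pieceMap n d '' K) {p q : ℝ × ℝ} (hp : p ∈ K) (hq : q ∈ K) :
    JoinedIn K p q := by
  obtain ⟨m, hm2, hm⟩ := exists_uniform_chain hD hcomp hconn hK
  have hm0 : 0 < m := by omega
  choose! w hw0 hwm hw using SameCell.refine hK hm
  let z : ℕ → ℕ → ℝ × ℝ := fun k => Nat.rec (fun j => if j = 0 then p else q)
    (fun k zk j => w k (zk (j / m)) (zk (j / m + 1)) (j % m)) k
  have hzs : ∀ k j, z (k+1) j = w k (z k (j / m)) (z k (j / m + 1)) (j % m) := fun k j => rfl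
  have hz0 : ∀ j, z 0 j = if j = 0 then p else q := fun j => rfl
  have hcell : ∀ k j, SameCell n D K k (z k j) (z k (j+1)) := by
    intro k
    induction k with
    | zero =>
      intro j
      simp only [hz0]
      constructor <;> split_ifs <;> assumption
    | succ k ih =>
      intro j
      rw [hzs, hzs]
      have hj := ih (j / m)
      have hlt := Nat.mod_lt j hm0
      by_cases h : j % m + 1 < m
      · have e1 : (j + 1) / m = j / m := by
          rw [Nat.div_eq_iff hm0]
          have := Nat.div_add_mod j m
          rw [mul_comm] at this
          constructor <;> omega
        have e2 : (j + 1) % m = j % m + 1 := by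
          have a := Nat.div_add_mod j m
          have b := Nat.div_add_mod (j+1) m
          rw [e1] at b
          omega
        rw [e1, e2]
        exact (hw k _ _ hj _ hlt).1
      · have e0 : j % m + 1 = m := by omega
        have e1 : (j + 1) / m = j / m + 1 := by
          rw [Nat.div_eq_iff hm0]
          have := Nat.div_add_mod j m
          rw [mul_comm] at this
          rw [add_mul]
          constructor <;> omega
        have e2 : (j + 1) % m = 0 := by
          have a := Nat.div_add_mod j m
          have b := Nat.div_add_mod (j+1) m
          rw [e1, mul_add] at b
          omega
        rw [e1, e2, hw0 k _ _ (ih (j/m + 1))]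
        have := (hw k _ _ hj _ hlt).1
        rwa [e0, hwm k _ _ hj] at this
  obtain ⟨C, hC⟩ := Metric.isBounded_iff.1 hcomp.isBounded
  have hC' : ∀ x ∈ K, ∀ y ∈ K, dist x y ≤ C := fun x hx y hy => hC hx hy
  have hmul : ∀ k j, z (k+1) (j * m) = z k j := by
    intro k j
    rw [hzs, Nat.mul_div_cancel _ hm0, Nat.mul_mod_left, hw0 k _ _ (hcell k j)]
  refine joinedIn_of_chains hcomp.isClosed hm2 (C := C) (r := (n:ℝ)⁻¹) (by positivity)
    (inv_lt_one_of_one_lt₀ (by exact_mod_cast hn)) (z := z)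
    (fun k j => (hcell k j).dist_le hC') ?_ ?_ ?_ (fun k j => (SameCell.mem hK (hcell k j)).1)
  · intro k j
    rw [hzs]
    exact (hw k _ _ (hcell k (j / m)) _ (Nat.mod_lt j hm0)).2.dist_le hC'
  · intro k
    induction k with
    | zero => simp [hz0]
    | succ k ih =>
      have := hmul k 0
      rw [zero_mul] at this
      rw [this, ih]
  · intro k
    induction k with
    | zero => simp [hz0]
    | succ k ih => rw [pow_succ, hmul, ih]

lemma pieceMap_fst (n : ℕ) (d : ℤ × ℤ) (x : ℝ × ℝ) : (pieceMap n d x).1 = (x.1 + d.1) / n := by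
  simp [pieceMap, coeZ2, div_eq_inv_mul, mul_add]

lemma pieceMap_snd (n : ℕ) (d : ℤ × ℤ) (x : ℝ × ℝ) : (pieceMap n d x).2 = (x.2 + d.2) / n := by
  simp [pieceMap, coeZ2, div_eq_inv_mul, mul_add]

lemma JoinedIn.exists_value {X : Type*} [TopologicalSpace X] {S : Set X} {x y : X}
    (h : JoinedIn S x y) {f : X → ℝ} (hf : Continuous f) {v : ℝ} (h1 : f x ≤ v) (h2 : v ≤ f y) :
    ∃ u ∈ S, f u = v := by
  obtain ⟨p, hp⟩ := h
  obtain ⟨t, ht⟩ := mem_range_of_exists_le_of_exists_ge (f := fun t => f (p t)) (c := v)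
    (hf.comp p.continuous) ⟨0, by simpa using h1⟩ ⟨1, by simpa using h2⟩
  exact ⟨p t, hp t, ht⟩

lemma fractal_coord_bounds {n : ℕ} {D : Set (ℤ × ℤ)} {K : Set (ℝ × ℝ)} (hn : 2 ≤ n)
    (hcomp : IsCompact K) (hK : K = ⋃ d ∈ D, pieceMap n d '' K)
    (g : ℝ × ℝ → ℝ) (hg : Continuous g) (e : ℤ × ℤ → ℤ)
    (hge : ∀ d ∈ D, ∀ x, g (pieceMap n d x) = (g x + e d) / n)
    (he : ∀ d ∈ D, 0 ≤ e d ∧ e d ≤ (n:ℤ) - 1) : ∀ x ∈ K, g x ∈ Icc (0:ℝ) 1 := by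
  intro x hx
  have hn' : (2:ℝ) ≤ n := by exact_mod_cast hn
  have he' : ∀ d ∈ D, (0:ℝ) ≤ e d ∧ (e d : ℝ) ≤ n - 1 := fun d hd => by
    have := he d hd
    constructor
    · exact_mod_cast this.1
    · exact_mod_cast this.2
  constructor
  · obtain ⟨a, ha, hmin⟩ := hcomp.exists_isMinOn ⟨x, hx⟩ hg.continuousOn
    obtain ⟨d, hd, y, hy, rfl⟩ := exists_of_mem hK ha
    have h1 : g (pieceMap n d y) ≤ g y := hmin hy
    have h2 : g (pieceMap n d y) ≤ g x := hmin hx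
    have h3 : n * g (pieceMap n d y) = g y + e d := by
      rw [hge d hd]
      field_simp
    nlinarith [he' d hd]
  · obtain ⟨a, ha, hmax⟩ := hcomp.exists_isMaxOn ⟨x, hx⟩ hg.continuousOn
    obtain ⟨d, hd, y, hy, rfl⟩ := exists_of_mem hK ha
    have h1 : g y ≤ g (pieceMap n d y) := hmax hy
    have h2 : g x ≤ g (pieceMap n d y) := hmax hx
    have h3 : n * g (pieceMap n d y) = g y + e d := by
      rw [hge d hd]
      field_simp
    nlinarith [he' d hd]

lemma full_column {n : ℕ} (hn : 2 ≤ n) {E : Set ℝ} (hcl : IsClosed E) (hE : E ⊆ Icc 0 1) {S : Set ℤ}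
    (H : ∀ y ∈ E, ∃ j ∈ S, (n:ℝ) * y - j ∈ E) {a b : ℝ} (hab : a < b) (hI : Icc a b ⊆ E) :
    Icc 0 1 ⊆ E ∧ ∀ j : ℤ, 0 ≤ j → j < n → j ∈ S := by
  have hn' : (2:ℝ) ≤ n := by exact_mod_cast hn
  have hP : ∀ k : ℕ, ∀ i : ℤ, (∀ y : ℝ, (i:ℝ) < (n:ℝ)^k * y → (n:ℝ)^k * y < i + 1 → y ∈ E) →
      Ioo (0:ℝ) 1 ⊆ E := by
    intro k
    induction k with
    | zero =>
      intro i hi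
      simp only [pow_zero, one_mul] at hi
      have := hE (hi (i + 1/2) (by linarith) (by linarith))
      have h1 : i = 0 := by
        have a1 : -1 < i := by
          have : (-1:ℝ) < i := by linarith [this.1]
          exact_mod_cast this
        have a2 : i < 1 := by
          have : (i:ℝ) < 1 := by linarith [this.2]
          exact_mod_cast this
        omega
      subst h1
      intro y hy
      exact hi y (by simpa using hy.1) (by simpa using hy.2)
    | succ k ih =>
      intro i hi
      have hnk : (0:ℤ) < (n:ℤ)^k := by positivity
      have hnk' : (0:ℝ) < (n:ℝ)^k := by positivity
      apply ih (i % (n:ℤ)^k)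
      intro y hy1 hy2
      have hr0 : (0:ℝ) ≤ ((i % (n:ℤ)^k : ℤ) : ℝ) := by exact_mod_cast Int.emod_nonneg i hnk.ne'
      have hr1 : ((i % (n:ℤ)^k : ℤ) : ℝ) + 1 ≤ (n:ℝ)^k := by
        exact_mod_cast Int.emod_lt_of_pos i hnk
      have hdiv : (n:ℝ)^k * ((i / (n:ℤ)^k : ℤ) : ℝ) + ((i % (n:ℤ)^k : ℤ) : ℝ) = i := by
        exact_mod_cast Int.mul_ediv_add_emod i ((n:ℤ)^k)
      have hy0 : 0 < y := by
        by_contra h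
        nlinarith
      have hy1' : y < 1 := by
        by_contra h
        nlinarith
      set q := i / (n:ℤ)^k
      have hmul : (n:ℝ)^(k+1) * ((y + q) / n) = (n:ℝ)^k * y + (n:ℝ)^k * q := by
        field_simp
        ring
      obtain ⟨j, hj, hjE⟩ := H _ (hi ((y + q) / n) (by rw [hmul]; linarith) (by rw [hmul]; linarith))
      have e1 : (n:ℝ) * ((y + q) / n) = y + q := by field_simp
      rw [e1] at hjE
      have hb := hE hjE
      have : q = j := by
        have a1 : q - j < 1 := by
          have : (q:ℝ) - j < 1 := by linarith [hb.2]
          exact_mod_cast this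
        have a2 : -1 < q - j := by
          have : (-1:ℝ) < q - j := by linarith [hb.1]
          exact_mod_cast this
        omega
      rw [this] at hjE
      simpa using hjE
  have hfull : Ioo (0:ℝ) 1 ⊆ E := by
    obtain ⟨k, hk⟩ := pow_unbounded_of_one_lt (2 / (b - a)) (show (1:ℝ) < n by linarith)
    have hk2 : 2 < (n:ℝ)^k * (b - a) := by
      rwa [div_lt_iff₀ (by linarith)] at hk
    have hnk' : (0:ℝ) < (n:ℝ)^k := by positivity
    apply hP k ⌈(n:ℝ)^k * a⌉
    intro y hy1 hy2
    have c1 := Int.le_ceil ((n:ℝ)^k * a)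
    have c2 := Int.ceil_lt_add_one ((n:ℝ)^k * a)
    apply hI
    constructor
    · by_contra h
      nlinarith
    · by_contra h
      nlinarith
  refine ⟨?_, ?_⟩
  · rw [← closure_Ioo (zero_ne_one)]
    exact hcl.closure_subset_iff.2 hfull
  · intro j hj0 hjn
    have hj0' : (0:ℝ) ≤ j := by exact_mod_cast hj0
    have hjn' : (j:ℝ) + 1 ≤ n := by exact_mod_cast hjn
    obtain ⟨j', hj', hE'⟩ := H (((j:ℝ) + 1/2) / n) (hfull ⟨by positivity, by
      rw [div_lt_one (by linarith)]
      linarith⟩)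
    have e1 : (n:ℝ) * (((j:ℝ) + 1/2) / n) = j + 1/2 := by field_simp
    rw [e1] at hE'
    have hb := hE hE'
    have : j = j' := by
      have a1 : j - j' < 1 := by
        have : (j:ℝ) - j' < 1 := by linarith [hb.2]
        exact_mod_cast this
      have a2 : -1 < j - j' := by
        have : (-1:ℝ) < j - j' := by linarith [hb.1]
        exact_mod_cast this
      omega
    rwa [this]

/-- The facts about a fractal square that we use. -/
structure GoodSquare (n : ℕ) (D : Set (ℤ × ℤ)) (K : Set (ℝ × ℝ)) : Prop where
  hn : 2 ≤ n
  dig : D ⊆ Set.Icc (0, 0) ((n : ℤ) - 1, (n : ℤ) - 1)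
  card : Nat.card D < n ^ 2
  comp : IsCompact K
  eq : K = ⋃ d ∈ D, pieceMap n d '' K
  conn : IsPreconnected K
  circ : ¬ ∃ S : Set (ℝ × ℝ), S ⊆ K ∧ Nonempty (S ≃ₜ Circle)

namespace GoodSquare

variable {n : ℕ} {D : Set (ℤ × ℤ)} {K : Set (ℝ × ℝ)}

lemma fst_mem (h : GoodSquare n D K) : ∀ x ∈ K, x.1 ∈ Icc (0:ℝ) 1 :=
  fractal_coord_bounds h.hn h.comp h.eq Prod.fst continuous_fst Prod.fst
    (fun d _ x => pieceMap_fst n d x) (fun _ hd => ⟨(h.dig hd).1.1, (h.dig hd).2.1⟩)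

lemma snd_mem (h : GoodSquare n D K) : ∀ x ∈ K, x.2 ∈ Icc (0:ℝ) 1 :=
  fractal_coord_bounds h.hn h.comp h.eq Prod.snd continuous_snd Prod.snd
    (fun d _ x => pieceMap_snd n d x) (fun _ hd => ⟨(h.dig hd).1.2, (h.dig hd).2.2⟩)

lemma joined (h : GoodSquare n D K) {p q : ℝ × ℝ} (hp : p ∈ K) (hq : q ∈ K) : JoinedIn K p q :=
  joinedIn_fractal h.hn ((Set.finite_Icc _ _).subset h.dig) h.comp h.conn h.eq hp hq

lemma piece_subset (h : GoodSquare n D K) {d : ℤ × ℤ} (hd : d ∈ D) : pieceMap n d '' K ⊆ K := by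
  rintro _ ⟨x, hx, rfl⟩
  exact pieceMap_mem h.eq hd hx

lemma column (h : GoodSquare n D K) (e : ℝ) (c : ℤ)
    (hc : ∀ d ∈ D, ∀ y ∈ K, (y.1 + d.1) / n = e → y.1 = e ∧ d.1 = c)
    {a b : ℝ} (hab : a < b) (hI : ∀ y ∈ Icc a b, (e, y) ∈ K) :
    (∀ y ∈ Icc (0:ℝ) 1, (e, y) ∈ K) ∧ ∀ j : ℤ, 0 ≤ j → j < n → (c, j) ∈ D := by
  have hn : (0:ℝ) < n := by have := h.hn; positivity
  refine full_column h.hn (E := {y | (e, y) ∈ K}) (S := {j | (c, j) ∈ D})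
    (h.comp.isClosed.preimage (by fun_prop)) (fun y hy => h.snd_mem _ hy) ?_ hab hI
  intro y hy
  obtain ⟨d, hd, z, hz, hdz⟩ := exists_of_mem h.eq hy
  have h1 := congrArg Prod.fst hdz
  have h2 := congrArg Prod.snd hdz
  rw [pieceMap_fst] at h1
  rw [pieceMap_snd] at h2
  simp only at h1 h2
  obtain ⟨h3, h4⟩ := hc d hd z hz h1
  refine ⟨d.2, ?_, ?_⟩
  · change (c, d.2) ∈ D
    rw [← h4]
    exact hd
  · change (e, (n:ℝ) * y - d.2) ∈ K
    have : (n:ℝ) * y - d.2 = z.2 := by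
      rw [← h2]
      field_simp
      ring
    rw [this, ← h3]
    exact hz

lemma no_sides (h : GoodSquare n D K) {a b : ℝ} (hab : a < b)
    (h0 : ∀ y ∈ Icc a b, ((0:ℝ), y) ∈ K) (h1 : ∀ y ∈ Icc a b, ((1:ℝ), y) ∈ K) : False := by
  have hn2 : (2:ℝ) ≤ n := by exact_mod_cast h.hn
  have hn0 : (0:ℝ) < n := by linarith
  obtain ⟨l1, l2⟩ := h.column 0 0 (fun d hd y hy e => by
    have b1 := (h.fst_mem y hy).1
    have b2 : (0:ℝ) ≤ d.1 := by exact_mod_cast (h.dig hd).1.1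
    rw [div_eq_zero_iff, or_iff_left hn0.ne'] at e
    refine ⟨by linarith, ?_⟩
    have : (d.1:ℝ) = 0 := by linarith
    exact_mod_cast this) hab h0
  obtain ⟨r1, r2⟩ := h.column 1 (n - 1) (fun d hd y hy e => by
    have b1 := (h.fst_mem y hy).2
    have b2 : (d.1:ℝ) ≤ n - 1 := by exact_mod_cast (h.dig hd).2.1
    rw [div_eq_one_iff_eq hn0.ne'] at e
    refine ⟨by linarith, ?_⟩
    have : (d.1:ℝ) = n - 1 := by linarith
    exact_mod_cast this) hab h1
  have hn3 : 3 ≤ n := by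
    by_contra hlt
    obtain rfl : n = 2 := by have := h.hn; omega
    have hD : D = Set.Icc (0, 0) (1, 1) := by
      apply Subset.antisymm
      · simpa using h.dig
      · rintro ⟨i, j⟩ ⟨⟨hi, hj⟩, hi', hj'⟩
        simp only at hi hj hi' hj'
        have : i = 0 ∨ i = 1 := by omega
        rcases this with rfl | rfl
        · exact l2 j hj (by norm_num; omega)
        · simpa using r2 j hj (by norm_num; omega)
    have hc := h.card
    rw [hD, Nat.card_eq_fintype_card] at hc
    revert hc
    decide
  have hn3' : (3:ℝ) ≤ n := by exact_mod_cast hn3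
  have d0 : ((0:ℤ), (0:ℤ)) ∈ D := l2 0 le_rfl (by omega)
  have d1 : ((0:ℤ), (1:ℤ)) ∈ D := l2 1 (by norm_num) (by omega)
  have d2 : ((0:ℤ), (2:ℤ)) ∈ D := l2 2 (by norm_num) (by omega)
  have k00 : ((0:ℝ), (0:ℝ)) ∈ K := l1 0 (by simp)
  have k10 : ((1:ℝ), (0:ℝ)) ∈ K := r1 0 (by simp)
  have pm : ∀ j : ℤ, ∀ x y : ℝ, pieceMap n (0, j) (x, y) = (x / n, (y + j) / n) := by
    intro j x y
    ext
    · simp [pieceMap_fst]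
    · simp [pieceMap_snd]
  have h2n : (2:ℝ) / n ≤ 1 := by
    rw [div_le_one hn0]
    linarith
  let A1 : Set (ℝ × ℝ) := {(0:ℝ)} ×ˢ Icc 0 (2 / (n:ℝ))
  let A3 : Set (ℝ × ℝ) := {1 / (n:ℝ)} ×ˢ Icc 0 (2 / (n:ℝ))
  let A2 : Set (ℝ × ℝ) := pieceMap n (0, 0) '' K
  have hseg : ∀ c : ℝ, ∀ y ∈ Icc (0:ℝ) (2 / n), ∀ y' ∈ Icc (0:ℝ) (2 / n),
      JoinedIn ({c} ×ˢ Icc 0 (2 / (n:ℝ))) (c, y) (c, y') := by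
    intro c y hy y' hy'
    have hconv : Convex ℝ ({c} ×ˢ Icc 0 (2 / (n:ℝ))) := (convex_singleton c).prod (convex_Icc _ _)
    have hm : ∀ v ∈ Icc (0:ℝ) (2 / n), (c, v) ∈ ({c} ×ˢ Icc 0 (2 / (n:ℝ)) : Set (ℝ × ℝ)) :=
      fun v hv => ⟨mem_singleton c, hv⟩
    exact (hconv.isPathConnected ⟨(c, y), hm y hy⟩).joinedIn _ (hm y hy) _ (hm y' hy')
  have m0 : (0:ℝ) ∈ Icc (0:ℝ) (2 / n) := ⟨le_rfl, by positivity⟩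
  have m2 : (2:ℝ) / n ∈ Icc (0:ℝ) (2 / n) := ⟨by positivity, le_rfl⟩
  have j1 : JoinedIn (A1 ∪ A2 ∪ A3) ((0:ℝ), (2:ℝ) / n) (0, 0) :=
    (hseg 0 _ m2 _ m0).mono (fun x hx => Or.inl (Or.inl hx))
  have j2 : JoinedIn (A1 ∪ A2 ∪ A3) ((0:ℝ), (0:ℝ)) (1 / n, 0) := by
    have := (h.joined k00 k10).map (continuous_pieceMap n (0, 0))
    rw [pm, pm] at this
    simp only [zero_div, Int.cast_zero, add_zero] at this
    exact this.mono (fun x hx => Or.inl (Or.inr hx))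
  have j3 : JoinedIn (A1 ∪ A2 ∪ A3) ((1:ℝ) / n, (0:ℝ)) (1 / n, 2 / n) :=
    (hseg (1 / n) _ m0 _ m2).mono (fun x hx => Or.inr hx)
  have jA := (j1.trans j2).trans j3
  have jB : JoinedIn (pieceMap n (0, 2) '' K) ((0:ℝ), (2:ℝ) / n) (1 / n, 2 / n) := by
    have := (h.joined k00 k10).map (continuous_pieceMap n (0, 2))
    rw [pm, pm] at this
    simpa using this
  have hA : A1 ∪ A2 ∪ A3 ⊆ K := by
    rintro ⟨x, y⟩ ((⟨hx, hy⟩ | hx) | ⟨hx, hy⟩)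
    · simp only [mem_singleton_iff] at hx
      subst hx
      exact l1 y ⟨hy.1, hy.2.trans h2n⟩
    · exact h.piece_subset d0 hx
    · simp only [mem_singleton_iff] at hx
      subst hx
      simp only [mem_Icc] at hy
      have hy2 : (n:ℝ) * y ≤ 2 := by
        have := hy.2
        rw [le_div_iff₀ hn0] at this
        linarith
      have hy0 : 0 ≤ (n:ℝ) * y := mul_nonneg hn0.le hy.1
      rcases le_total ((n:ℝ) * y) 1 with hle | hle
      · have := pieceMap_mem h.eq d0 (r1 ((n:ℝ) * y) ⟨hy0, hle⟩)
        rw [pm] at this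
        convert this using 2
        field_simp
        simp
      · have := pieceMap_mem h.eq d1 (r1 ((n:ℝ) * y - 1) ⟨by linarith, by linarith⟩)
        rw [pm] at this
        convert this using 2
        field_simp
        simp
  have hne : ((0:ℝ), (2:ℝ) / n) ≠ ((1:ℝ) / n, (2:ℝ) / n) := by
    intro e
    have := congrArg Prod.fst e
    simp only at this
    have h3 : (0:ℝ) < 1 / n := by positivity
    linarith
  have hj := JoinedIn.inter_of_no_circle h.circ hA (h.piece_subset d2) hne jA jB
  have hpos : (0:ℝ) < 1 / n := by positivity
  obtain ⟨u, ⟨hu1, ⟨z, hz, hzu⟩⟩, huv⟩ := hj.exists_value (f := Prod.fst) (v := 1 / n / 2) continuous_fst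
    (by simp only; linarith) (by simp only; linarith)
  rcases hu1 with (hu1 | hu1) | hu1
  · have : u.1 = 0 := hu1.1
    linarith
  · obtain ⟨z', hz', e⟩ := hu1
    have e1 := congrArg Prod.snd (hzu.trans e.symm)
    rw [pieceMap_snd, pieceMap_snd, div_left_inj' hn0.ne'] at e1
    have b1 := h.snd_mem z hz
    have b2 := h.snd_mem z' hz'
    simp only [Int.cast_zero, Int.cast_ofNat] at e1
    linarith [b1.1, b2.2]
  · have : u.1 = 1 / n := hu1.1
    linarith

lemma main_h (h : GoodSquare n D K) {d d' : ℤ × ℤ} (hd : d ∈ D) (hd' : d' ∈ D) (hlt : d.1 < d'.1) :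
    ((pieceMap n d '' K) ∩ (pieceMap n d' '' K)).Subsingleton := by
  have hn0 : (0:ℝ) < n := by have := h.hn; positivity
  have hlt' : (d.1:ℝ) + 1 ≤ d'.1 := by exact_mod_cast hlt
  -- structure of points in the intersection
  have key : ∀ u ∈ (pieceMap n d '' K) ∩ (pieceMap n d' '' K),
      u.1 = (1 + d.1) / n ∧ ((1:ℝ), n * u.2 - d.2) ∈ K ∧ ((0:ℝ), n * u.2 - d'.2) ∈ K := by
    rintro u ⟨⟨s, hs, hsu⟩, ⟨t, ht, htu⟩⟩
    have e1 := congrArg Prod.fst hsu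
    have e2 := congrArg Prod.snd hsu
    have e3 := congrArg Prod.fst htu
    have e4 := congrArg Prod.snd htu
    rw [pieceMap_fst] at e1 e3
    rw [pieceMap_snd] at e2 e4
    have e5 := e1.trans e3.symm
    rw [div_left_inj' hn0.ne'] at e5
    have b1 := h.fst_mem s hs
    have b2 := h.fst_mem t ht
    have s1 : s.1 = 1 := by linarith [b1.2, b2.1]
    have t0 : t.1 = 0 := by linarith [b1.2, b2.1]
    refine ⟨by rw [← e1, s1], ?_, ?_⟩
    · have : (n:ℝ) * u.2 - d.2 = s.2 := by
        rw [← e2]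
        field_simp
        ring
      rw [this, ← s1]
      exact hs
    · have : (n:ℝ) * u.2 - d'.2 = t.2 := by
        rw [← e4]
        field_simp
        ring
      rw [this, ← t0]
      exact ht
  have joined_piece : ∀ e, ∀ x ∈ pieceMap n e '' K, ∀ y ∈ pieceMap n e '' K,
      JoinedIn (pieceMap n e '' K) x y := by
    rintro e _ ⟨x, hx, rfl⟩ _ ⟨y, hy, rfl⟩
    exact (h.joined hx hy).map (continuous_pieceMap n e)
  have step : ∀ x ∈ (pieceMap n d '' K) ∩ (pieceMap n d' '' K),
      ∀ y ∈ (pieceMap n d '' K) ∩ (pieceMap n d' '' K), ¬ x.2 < y.2 := by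
    intro x hx y hy hxy
    have hne : x ≠ y := fun e => by rw [e] at hxy; exact lt_irrefl _ hxy
    have hj := JoinedIn.inter_of_no_circle h.circ (h.piece_subset hd) (h.piece_subset hd') hne
      (joined_piece d x hx.1 y hy.1) (joined_piece d' x hx.2 y hy.2)
    have hnxy : (n:ℝ) * x.2 < n * y.2 := mul_lt_mul_of_pos_left hxy hn0
    have kx := key x hx
    have ky := key y hy
    have b1 := h.snd_mem _ kx.2.1
    have b2 := h.snd_mem _ kx.2.2
    have b3 := h.snd_mem _ ky.2.1
    have b4 := h.snd_mem _ ky.2.2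
    simp only [mem_Icc] at b1 b2 b3 b4
    have hd2 : d.2 = d'.2 := by
      have a1 : d.2 - d'.2 < 1 := by
        have : (d.2:ℝ) - d'.2 < 1 := by linarith
        exact_mod_cast this
      have a2 : -1 < d.2 - d'.2 := by
        have : (-1:ℝ) < d.2 - d'.2 := by linarith
        exact_mod_cast this
      omega
    have hval : ∀ w ∈ Icc ((n:ℝ) * x.2 - d.2) (n * y.2 - d.2), ((0:ℝ), w) ∈ K ∧ ((1:ℝ), w) ∈ K := by
      intro w hw
      obtain ⟨u, hu, huv⟩ := hj.exists_value (f := Prod.snd) (v := (w + d.2) / n) continuous_snd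
        (by rw [le_div_iff₀ hn0]; linarith [hw.1]) (by rw [div_le_iff₀ hn0]; linarith [hw.2])
      have ku := key u hu
      rw [← hd2] at ku
      have : (n:ℝ) * u.2 - d.2 = w := by
        rw [huv]
        field_simp
        ring
      rw [this] at ku
      exact ⟨ku.2.2, ku.2.1⟩
    exact h.no_sides (by linarith) (fun w hw => (hval w hw).1) (fun w hw => (hval w hw).2)
  intro x hx y hy
  apply Prod.ext
  · rw [(key x hx).1, (key y hy).1]
  · exact le_antisymm (not_lt.1 (step y hy x hx)) (not_lt.1 (step x hx y hy))

lemma main_h' (h : GoodSquare n D K) {d d' : ℤ × ℤ} (hd : d ∈ D) (hd' : d' ∈ D) (hne : d.1 ≠ d'.1) :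
    ((pieceMap n d '' K) ∩ (pieceMap n d' '' K)).Subsingleton := by
  rcases lt_or_gt_of_ne hne with hlt | hlt
  · exact h.main_h hd hd' hlt
  · rw [inter_comm]
    exact h.main_h hd' hd hlt

lemma swap_pieceMap (n : ℕ) (d : ℤ × ℤ) (K : Set (ℝ × ℝ)) :
    Prod.swap '' (pieceMap n d '' K) = pieceMap n d.swap '' (Prod.swap '' K) := by
  rw [image_image, image_image]
  rfl

lemma swap (h : GoodSquare n D K) : GoodSquare n (Prod.swap '' D) (Prod.swap '' K) where
  hn := h.hn
  dig := by
    rintro _ ⟨d, hd, rfl⟩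
    have := h.dig hd
    exact ⟨⟨this.1.2, this.1.1⟩, ⟨this.2.2, this.2.1⟩⟩
  card := by
    rw [Nat.card_image_of_injective Prod.swap_injective]
    exact h.card
  comp := h.comp.image continuous_swap
  eq := by
    conv_lhs => rw [h.eq]
    rw [image_iUnion₂, biUnion_image]
    simp only [swap_pieceMap]
  conn := h.conn.image _ continuous_swap.continuousOn
  circ := by
    rintro ⟨S, hS, ⟨e⟩⟩
    refine h.circ ⟨Prod.swap '' S, ?_, ⟨?_⟩⟩
    · rintro _ ⟨x, hx, rfl⟩
      obtain ⟨y, hy, rfl⟩ := hS hx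
      simpa using hy
    · exact ((Homeomorph.prodComm ℝ ℝ).image S).symm.trans e

end GoodSquare

/-- If a fractal square `K` is a dendrite, then it possesses the
one-point intersection property: two distinct first-order pieces meet in at most
one point. -/
theorem fractalSquare_dendrite_onePointIntersection
    (n : ℕ) (D : Set (ℤ × ℤ)) (K : Set (ℝ × ℝ))
    (hK : IsFractalSquare n D K) (hden : IsDendrite K) :
    ∀ d ∈ D, ∀ d' ∈ D, d ≠ d' →
      ((pieceMap n d '' K) ∩ (pieceMap n d' '' K)).Subsingleton := by
  have h : GoodSquare n D K :=
    ⟨hK.1, hK.2.1, hK.2.2.2.1, hK.2.2.2.2.2.1, hK.2.2.2.2.2.2, hden.2.2.1.isPreconnected,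
      hden.2.2.2.2⟩
  intro d hd d' hd' hne
  by_cases h1 : d.1 = d'.1
  · have h2 : d.2 ≠ d'.2 := fun h2 => hne (Prod.ext h1 h2)
    have := h.swap.main_h' (mem_image_of_mem _ hd) (mem_image_of_mem _ hd') h2
    rw [← GoodSquare.swap_pieceMap, ← GoodSquare.swap_pieceMap,
      ← image_inter Prod.swap_injective] at this
    exact Set.subsingleton_of_image Prod.swap_injective _ this
  · exact h.main_h' hd hd' h1
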